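/- Let H be a bialgebra over a field k and let C be a left H-module coalgebra with action ▷. Let D be a coalgebra, ι: D → C a coalgebra homomorphism, and P: C → D a k-linear map with P∘ι = id_D, Δ_D∘P = (P ⊗ P)∘Δ_C and ι(P(c)) = c₍₁₎ε_D(P(c₍₂₎)) = ε_D(P(c₍₁₎))c₍₂₎ for all c ∈ C. Then the map H ⊗ D → D, h ⊗ d ↦ h·d := P(h▷ι(d)), makes D a symmetric left partial H-module coalgebra, i.e. it satisfies (PLHMC1), (PLHMC2), (PLHMC3) and (PLHMC3'). -/

import Mathlib

open TensorProduct

/-- `sw4 k f₁ f₂ h c = ∑ f₁(h₍₁₎ ⊗ c₍₁₎) ⊗ f₂(h₍₂₎ ⊗ c₍₂₎)` in Sweedler notation. -/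
noncomputable def sw4 (k : Type*) [Field k] {H C M N : Type*}
    [AddCommGroup H] [Module k H] [Coalgebra k H]
    [AddCommGroup C] [Module k C] [Coalgebra k C]
    [AddCommGroup M] [Module k M] [AddCommGroup N] [Module k N]
    (f₁ : H ⊗[k] C →ₗ[k] M) (f₂ : H ⊗[k] C →ₗ[k] N) (h : H) (c : C) : M ⊗[k] N :=
  (TensorProduct.map f₁ f₂)
    ((TensorProduct.tensorTensorTensorComm k H H C C)
      ((Coalgebra.comul (R := k) h) ⊗ₜ[k] (Coalgebra.comul (R := k) c)))
/-- A left partial `H`-module coalgebra: (PLHMC1) `Δ(h·c) = ∑ (h₍₁₎·c₍₁₎) ⊗ (h₍₂₎·c₍₂₎)`;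
(PLHMC2) `1·c = c`; (PLHMC3) `h·(g·c) = ∑ (hg₍₁₎·c₍₁₎) ε(g₍₂₎·c₍₂₎)`. -/
structure IsPartialModuleCoalgebra (k : Type*) [Field k] {H C : Type*} [Ring H] [Bialgebra k H]
    [AddCommGroup C] [Module k C] [Coalgebra k C] (act : H →ₗ[k] C →ₗ[k] C) : Prop where
  plhmc1 : ∀ (h : H) (c : C), Coalgebra.comul (R := k) (act h c) =
    sw4 k (TensorProduct.lift act) (TensorProduct.lift act) h c
  plhmc2 : ∀ c : C, act 1 c = c
  plhmc3 : ∀ (h g : H) (c : C), act h (act g c) =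
    (TensorProduct.rid k C) (sw4 k
      (TensorProduct.lift act ∘ₗ TensorProduct.map (LinearMap.mulLeft k h) LinearMap.id)
      (Coalgebra.counit ∘ₗ TensorProduct.lift act) g c)
/-- A symmetric left partial `H`-module coalgebra: a left partial `H`-module coalgebra
which moreover satisfies (PLHMC3') `h·(g·c) = ∑ ε(g₍₁₎·c₍₁₎) (hg₍₂₎·c₍₂₎)`. -/
structure IsSymmPartialModuleCoalgebra (k : Type*) [Field k] {H C : Type*}
    [Ring H] [Bialgebra k H] [AddCommGroup C] [Module k C] [Coalgebra k C]
    (act : H →ₗ[k] C →ₗ[k] C) extends IsPartialModuleCoalgebra k act : Prop where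
  plhmc3' : ∀ (h g : H) (c : C), act h (act g c) =
    (TensorProduct.lid k C) (sw4 k
      (Coalgebra.counit ∘ₗ TensorProduct.lift act)
      (TensorProduct.lift act ∘ₗ TensorProduct.map (LinearMap.mulLeft k h) LinearMap.id) g c)

theorem map_sw4 {k H C M N M' N' : Type*} [Field k]
    [AddCommGroup H] [Module k H] [Coalgebra k H]
    [AddCommGroup C] [Module k C] [Coalgebra k C]
    [AddCommGroup M] [Module k M] [AddCommGroup N] [Module k N]
    [AddCommGroup M'] [Module k M'] [AddCommGroup N'] [Module k N']
    (g₁ : M →ₗ[k] M') (g₂ : N →ₗ[k] N')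
    (f₁ : H ⊗[k] C →ₗ[k] M) (f₂ : H ⊗[k] C →ₗ[k] N) (h : H) (c : C) :
    TensorProduct.map g₁ g₂ (sw4 k f₁ f₂ h c) = sw4 k (g₁ ∘ₗ f₁) (g₂ ∘ₗ f₂) h c := by
  simp only [sw4, TensorProduct.map_comp, LinearMap.comp_apply]

theorem sw4_coalgHom_apply {k H C D M N : Type*} [Field k]
    [AddCommGroup H] [Module k H] [Coalgebra k H]
    [AddCommGroup C] [Module k C] [Coalgebra k C]
    [AddCommGroup D] [Module k D] [Coalgebra k D]
    [AddCommGroup M] [Module k M] [AddCommGroup N] [Module k N]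
    (ι : D →ₗc[k] C)
    (f₁ : H ⊗[k] C →ₗ[k] M) (f₂ : H ⊗[k] C →ₗ[k] N) (h : H) (d : D) :
    sw4 k f₁ f₂ h (ι d) =
      sw4 k (f₁ ∘ₗ TensorProduct.map LinearMap.id (ι : D →ₗ[k] C))
        (f₂ ∘ₗ TensorProduct.map LinearMap.id (ι : D →ₗ[k] C)) h d := by
  simp only [sw4, ← CoalgHomClass.map_comp_comul_apply ι d]
  generalize Coalgebra.comul (R := k) h = x
  generalize Coalgebra.comul (R := k) d = y
  induction x with
  | zero => simp
  | add x₁ x₂ h₁ h₂ => simp only [TensorProduct.add_tmul, map_add, h₁, h₂]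
  | tmul a b =>
    induction y with
    | zero => simp
    | add y₁ y₂ h₁ h₂ => simp only [TensorProduct.tmul_add, map_add, h₁, h₂]
    | tmul a b => simp

theorem map_rid_apply {k M N : Type*} [Field k] [AddCommGroup M] [Module k M]
    [AddCommGroup N] [Module k N] (f : M →ₗ[k] N) (x : M ⊗[k] k) :
    f (TensorProduct.rid k M x) =
      TensorProduct.rid k N (TensorProduct.map f LinearMap.id x) := by
  induction x with
  | zero => simp
  | add x y hx hy => simp only [map_add, hx, hy]
  | tmul a b => simp

theorem map_lid_apply {k M N : Type*} [Field k] [AddCommGroup M] [Module k M]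
    [AddCommGroup N] [Module k N] (f : M →ₗ[k] N) (x : k ⊗[k] M) :
    f (TensorProduct.lid k M x) =
      TensorProduct.lid k N (TensorProduct.map LinearMap.id f x) := by
  induction x with
  | zero => simp
  | add x y hx hy => simp only [map_add, hx, hy]
  | tmul a b => simp

/-- Let `C` be a left `H`-module coalgebra over a bialgebra `H` with action `▷`, let
`ι : D → C` be a coalgebra homomorphism and `P : C → D` a linear map with `P∘ι = id`,
`Δ_D∘P = (P ⊗ P)∘Δ_C` and `ι(P(c)) = ∑ c₍₁₎ε_D(P(c₍₂₎)) = ∑ ε_D(P(c₍₁₎))c₍₂₎`.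
Then `h·d := P(h▷ι(d))` makes `D` a symmetric left partial `H`-module coalgebra. -/
theorem inducedPartialModuleCoalgebra
    {k H C D : Type*} [Field k] [Ring H] [Bialgebra k H]
    [AddCommGroup C] [Module k C] [Coalgebra k C]
    [AddCommGroup D] [Module k D] [Coalgebra k D]
    (mact : H →ₗ[k] C →ₗ[k] C)
    -- `C` is a (global) left `H`-module coalgebra:
    (hma1 : ∀ c : C, mact 1 c = c)
    (hma2 : ∀ (h g : H) (c : C), mact h (mact g c) = mact (h * g) c)
    (hma3 : ∀ (h : H) (c : C), Coalgebra.comul (R := k) (mact h c) =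
      sw4 k (TensorProduct.lift mact) (TensorProduct.lift mact) h c)
    (hma4 : ∀ (h : H) (c : C), Coalgebra.counit (R := k) (mact h c) =
      Coalgebra.counit (R := k) h * Coalgebra.counit (R := k) c)
    -- the projection data:
    (ι : D →ₗc[k] C) (P : C →ₗ[k] D)
    (hPι : ∀ d : D, P (ι d) = d)
    (hPcomul : ∀ c : C,
      Coalgebra.comul (R := k) (P c) = TensorProduct.map P P (Coalgebra.comul (R := k) c))
    (hPr : ∀ c : C, ι (P c) = (TensorProduct.rid k C)
      (TensorProduct.map LinearMap.id (Coalgebra.counit ∘ₗ P) (Coalgebra.comul (R := k) c)))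
    (hPl : ∀ c : C, ι (P c) = (TensorProduct.lid k C)
      (TensorProduct.map (Coalgebra.counit ∘ₗ P) LinearMap.id (Coalgebra.comul (R := k) c)))
    -- the induced map `h·d = P(h▷ι(d))`:
    (pact : H →ₗ[k] D →ₗ[k] D)
    (hpact : ∀ (h : H) (d : D), pact h d = P (mact h (ι d))) :
    IsSymmPartialModuleCoalgebra k pact := by
  have lift_pact : TensorProduct.lift pact =
      (P ∘ₗ TensorProduct.lift mact) ∘ₗ TensorProduct.map LinearMap.id (ι : D →ₗ[k] C) := by
    ext h d
    simp [hpact]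
  have lift_pact_mulLeft (h : H) :
      TensorProduct.lift pact ∘ₗ TensorProduct.map (LinearMap.mulLeft k h) LinearMap.id =
        ((P ∘ₗ mact h) ∘ₗ TensorProduct.lift mact) ∘ₗ
          TensorProduct.map LinearMap.id (ι : D →ₗ[k] C) := by
    ext g d
    simp [hpact, hma2]
  refine ⟨⟨fun h d => ?_, fun d => ?_, fun h g d => ?_⟩, fun h g d => ?_⟩
  · rw [hpact, hPcomul, hma3, map_sw4, sw4_coalgHom_apply, lift_pact]
  · rw [hpact, hma1, hPι]
  · rw [hpact h, hpact g, hPr, ← LinearMap.comp_apply P, map_rid_apply, hma3, map_sw4, map_sw4,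
      sw4_coalgHom_apply, lift_pact_mulLeft, lift_pact]
    rfl
  · rw [hpact h, hpact g, hPl, ← LinearMap.comp_apply P, map_lid_apply, hma3, map_sw4, map_sw4,
      sw4_coalgHom_apply, lift_pact_mulLeft, lift_pact]
    rfl
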